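/- arXiv:1801.05101 — 2 statements merged into one kernel-verified Lean document; each statement's English description precedes it below -/
import Mathlib

section
/- Let q be a prime power, F = GF(q), and E = GF(q^ℓ). Let S and T be F-subspaces of E, each of F-dimension ℓ − 1. Then the number of γ ∈ E* such that γS = T is exactly q − 1. Consequently, as γ ranges over E*, the collection {γS : γ ∈ E*} covers every (ℓ−1)-dimensional F-subspace of E exactly q − 1 times. -/
/-- Two linear functionals with nested kernels are proportional. -/
theorem exists_eq_smul_of_ker_le_ker {K V : Type*} [Field K] [AddCommGroup V] [Module K V]
    {f g : V →ₗ[K] K} (hf : f ≠ 0) (h : LinearMap.ker f ≤ LinearMap.ker g) :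
    ∃ c : K, g = c • f := by
  obtain ⟨v, hv⟩ : ∃ v, f v ≠ 0 := by
    by_contra! hv
    exact hf (LinearMap.ext hv)
  refine ⟨g v / f v, LinearMap.ext fun x => ?_⟩
  have hx : x - (f x / f v) • v ∈ LinearMap.ker f := by
    simp [hv]
  have hx' := h hx
  simp only [LinearMap.mem_ker, map_sub, map_smul, smul_eq_mul, sub_eq_zero] at hx'
  simp only [LinearMap.smul_apply, smul_eq_mul, hx']
  ring

/-- A subspace of codimension one is the kernel of a nonzero linear functional. -/
theorem exists_ne_zero_and_ker_eq {K V : Type*} [Field K] [AddCommGroup V] [Module K V]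
    [FiniteDimensional K V] (S : Submodule K V)
    (hS : Module.finrank K S + 1 = Module.finrank K V) :
    ∃ f : V →ₗ[K] K, f ≠ 0 ∧ LinearMap.ker f = S := by
  have hlt : S < ⊤ := by
    rw [lt_top_iff_ne_top]
    rintro rfl
    rw [finrank_top] at hS
    omega
  obtain ⟨f, hf, hle⟩ := S.exists_le_ker_of_lt_top hlt
  refine ⟨f, hf, (Submodule.eq_of_le_of_finrank_eq hle ?_).symm⟩
  have := Module.Dual.finrank_ker_add_one_of_ne_zero hf
  omega

/-- In a finite field extension, every linear functional is of the form `x ↦ g (b * x)`, for any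
fixed nonzero functional `g`. -/
theorem exists_comp_mulLeft_eq {F E : Type*} [Field F] [Field E] [Algebra F E]
    [FiniteDimensional F E] {g : E →ₗ[F] F} (hg : g ≠ 0) (f : E →ₗ[F] F) :
    ∃ b : E, g ∘ₗ LinearMap.mulLeft F b = f := by
  let φ : E →ₗ[F] (E →ₗ[F] F) := (LinearMap.mul F E).compr₂ g
  have hinj : Function.Injective φ := by
    rw [← LinearMap.ker_eq_bot, LinearMap.ker_eq_bot']
    intro b hb
    by_contra hb0
    refine hg (LinearMap.ext fun x => ?_)
    have h := LinearMap.congr_fun hb (b⁻¹ * x)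
    simpa [φ, hb0] using h
  obtain ⟨b, hb⟩ := (LinearMap.injective_iff_surjective_of_finrank_eq_finrank
    Subspace.dual_finrank_eq.symm).1 hinj f
  exact ⟨b, hb⟩

/-- Multiplication by `γ ≠ 0` carries `ker f` to `ker g` exactly when `ker f` is the kernel of
`x ↦ g (γ * x)`. -/
theorem map_mulLeft_ker_eq_ker_iff {F E : Type*} [Field F] [Field E] [Algebra F E]
    (f g : E →ₗ[F] F) {γ : E} (hγ : γ ≠ 0) :
    (LinearMap.ker f).map (LinearMap.mulLeft F γ) = LinearMap.ker g ↔
      LinearMap.ker f = LinearMap.ker (g ∘ₗ LinearMap.mulLeft F γ) := by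
  have hinj : Function.Injective (LinearMap.mulLeft F γ) := mul_right_injective₀ hγ
  have hsurj : Function.Surjective (LinearMap.mulLeft F γ) := mul_left_surjective₀ hγ
  rw [LinearMap.ker_comp]
  constructor
  · intro h
    rw [← h, Submodule.comap_map_eq_of_injective hinj]
  · intro h
    rw [h, Submodule.map_comap_eq_of_surjective hsurj]

/-- If `f = g (b * ·)`, the multipliers carrying `ker f` to `ker g` are the nonzero scalar multiples
of `b`. -/
theorem map_mulLeft_ker_comp_eq_ker_iff {F E : Type*} [Field F] [Field E] [Algebra F E]
    {g : E →ₗ[F] F} {b γ : E} (hb : g ∘ₗ LinearMap.mulLeft F b ≠ 0) :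
    (γ ≠ 0 ∧ (LinearMap.ker (g ∘ₗ LinearMap.mulLeft F b)).map (LinearMap.mulLeft F γ) =
      LinearMap.ker g) ↔ ∃ c : Fˣ, c • b = γ := by
  have hb0 : b ≠ 0 := by
    rintro rfl
    exact hb (by ext; simp)
  have hg : g ≠ 0 := by
    rintro rfl
    exact hb (LinearMap.zero_comp _)
  constructor
  · rintro ⟨hγ, h⟩
    rw [map_mulLeft_ker_eq_ker_iff _ _ hγ] at h
    obtain ⟨c, hc⟩ := exists_eq_smul_of_ker_le_ker hb h.le
    have hγb : γ = c • b := by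
      by_contra hne
      refine hg (LinearMap.ext fun x => ?_)
      have hd : γ - c • b ≠ 0 := sub_ne_zero.2 hne
      have h := LinearMap.congr_fun hc ((γ - c • b)⁻¹ * x)
      simp only [LinearMap.comp_apply, LinearMap.smul_apply, LinearMap.mulLeft_apply] at h
      rw [← map_smul, ← sub_eq_zero, ← map_sub, ← smul_mul_assoc, ← sub_mul,
        mul_inv_cancel_left₀ hd] at h
      simpa using h
    have hc0 : c ≠ 0 := by
      rintro rfl
      exact hγ (by simpa using hγb)
    exact ⟨Units.mk0 c hc0, hγb.symm⟩
  · rintro ⟨c, rfl⟩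
    have hcb : c • b ≠ 0 := by
      rw [Units.smul_def]
      exact smul_ne_zero c.ne_zero hb0
    refine ⟨hcb, (map_mulLeft_ker_eq_ker_iff _ _ hcb).2 ?_⟩
    ext x
    simp [Units.smul_def]

open scoped Classical in
/-- If `S` and `T` are `(ℓ−1)`-dimensional `F`-subspaces of `E = GF(q^ℓ)`,
then the number of `γ ∈ E*` with `γS = T` is exactly `q − 1`. -/
theorem stmt_4 (q ℓ : ℕ) (hq : IsPrimePow q) (hℓ : 1 ≤ ℓ)
    (F E : Type*) [Field F] [Fintype F] [Field E] [Fintype E] [Algebra F E]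
    (hF : Fintype.card F = q) (hE : Fintype.card E = q ^ ℓ)
    (S T : Submodule F E)
    (hS : Module.finrank F S = ℓ - 1) (hT : Module.finrank F T = ℓ - 1) :
    (Finset.univ.filter
        (fun γ : E => γ ≠ 0 ∧ S.map (LinearMap.mulLeft F γ) = T)).card = q - 1 := by
  have hdim : Module.finrank F E = ℓ := by
    have h := Module.card_eq_pow_finrank (K := F) (V := E)
    rw [hF, hE] at h
    exact (Nat.pow_right_injective hq.two_le h).symm
  obtain ⟨f, hf, rfl⟩ := exists_ne_zero_and_ker_eq S (by omega)
  obtain ⟨g, hg, rfl⟩ := exists_ne_zero_and_ker_eq T (by omega)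
  obtain ⟨b, rfl⟩ := exists_comp_mulLeft_eq hg f
  have hb0 : b ≠ 0 := by
    rintro rfl
    exact hf (by ext; simp)
  have hinj : Function.Injective fun c : Fˣ => c • b := fun c d h =>
    Units.ext (smul_left_injective F hb0 h)
  rw [← hF, ← Fintype.card_units, ← Finset.card_univ, ← Finset.card_image_of_injective _ hinj]
  congr 1
  ext γ
  simp only [Finset.mem_filter, Finset.mem_univ, true_and, Finset.mem_image]
  exact map_mulLeft_ker_comp_eq_ker_iff hf
end

section
/- Let E = GF(2^ℓ). For i ∈ [ℓ] let g_i(x) = b_i + a_i x with a_i, b_i ∈ E. Suppose {b₁, …, b_ℓ} = {g₁(0), …, g_ℓ(0)} is an F₂-basis of E, and that for every α ∈ E* the F₂-subspace span_{F₂}{g₁(α), …, g_ℓ(α)} has F₂-dimension ℓ − 1. Then the map α ↦ span_{F₂}{g₁(α), …, g_ℓ(α)} is injective on E*; consequently every (ℓ−1)-dimensional F₂-subspace of E occurs exactly once among these spans, i.e., every bandwidth-optimal linear repair scheme for a full-length Reed–Solomon code with n = 2^ℓ and r = n − k = 2 is rotational. -/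
section

variable {K E : Type*} [Field K] [Field E] [Algebra K E]

/-- The linear map `x ↦ x + f x * α`. -/
def repairMap (f : E →ₗ[K] E) (α : E) : E →ₗ[K] E :=
  LinearMap.id + (LinearMap.mulRight K α).comp f

theorem repairMap_apply (f : E →ₗ[K] E) (α x : E) : repairMap f α x = x + f x * α := rfl

/-- If no `repairMap f α` with `α ≠ 0` is injective, then `α ↦ -x / f x` covers all of `E*`,
which forces `f` to be injective. -/
theorem injective_of_forall_not_injective_repairMap [Finite E] (f : E →ₗ[K] E)
    (h : ∀ α : E, α ≠ 0 → ¬ Function.Injective (repairMap f α)) : Function.Injective f := by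
  have key (α : {α : E // α ≠ 0}) : ∃ x : {x : E // x ≠ 0}, x.1 + f x.1 * α.1 = 0 := by
    have hα := h α.1 α.2
    rw [injective_iff_map_eq_zero] at hα
    push Not at hα
    obtain ⟨x, hx, hx0⟩ := hα
    exact ⟨⟨x, hx0⟩, hx⟩
  choose x hx using key
  have hfx (α : {α : E // α ≠ 0}) : f (x α).1 ≠ 0 := fun h0 ↦ (x α).2 (by simpa [h0] using hx α)
  have hinj : Function.Injective x := by
    intro α β hαβ
    have hα := (hx α).trans (hx β).symm
    rw [hαβ] at hα
    exact Subtype.ext (mul_left_cancel₀ (hfx β) (add_left_cancel hα))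
  rw [injective_iff_map_eq_zero]
  intro y hy
  by_contra hy0
  obtain ⟨α, hα⟩ := Finite.surjective_of_injective hinj ⟨y, hy0⟩
  exact hfx α (by rw [hα]; exact hy)

theorem eq_of_range_repairMap_le {f : E →ₗ[K] E} (hf : Function.Surjective f)
    {H : Submodule K E} (hH : H ≠ ⊤) {α β : E} (hα : LinearMap.range (repairMap f α) ≤ H)
    (hβ : LinearMap.range (repairMap f β) ≤ H) : α = β := by
  by_contra hne
  refine hH (eq_top_iff.2 fun y _ ↦ ?_)
  obtain ⟨x, hx⟩ := hf (y / (α - β))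
  have h := H.sub_mem (hα ⟨x, rfl⟩) (hβ ⟨x, rfl⟩)
  rwa [repairMap_apply, repairMap_apply, add_sub_add_left_eq_sub, ← mul_sub, hx,
    div_mul_cancel₀ _ (sub_ne_zero.2 hne)] at h

theorem exists_range_repairMap_le_ker [FiniteDimensional K E] {f : E →ₗ[K] E}
    (hf : Function.Surjective f) {φ : Module.Dual K E} (hφ : φ ≠ 0) :
    ∃ α : E, α ≠ 0 ∧ LinearMap.range (repairMap f α) ≤ LinearMap.ker φ := by
  let Ψ : E →ₗ[K] Module.Dual K E :=
    ((LinearMap.mul K E).compr₂ φ).compl₂ f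
  have hΨ (α x : E) : Ψ α x = φ (α * f x) := rfl
  have hinj : Function.Injective Ψ := by
    rw [injective_iff_map_eq_zero]
    intro α hα
    by_contra hα0
    refine hφ (LinearMap.ext fun y ↦ ?_)
    obtain ⟨x, hx⟩ := hf (y / α)
    have h := hΨ α x
    rwa [hα, hx, mul_div_cancel₀ _ hα0, eq_comm] at h
  obtain ⟨α, hα⟩ := (LinearMap.injective_iff_surjective_of_finrank_eq_finrank
    Subspace.dual_finrank_eq.symm).1 hinj (-φ)
  refine ⟨α, ?_, ?_⟩
  · rintro rfl
    rw [map_zero, zero_eq_neg] at hα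
    exact hφ hα
  · rintro _ ⟨x, rfl⟩
    rw [LinearMap.mem_ker, repairMap_apply, map_add, mul_comm, ← hΨ, hα]
    simp

end


/-- Let `E = GF(2^ℓ)` and `g_i(x) = b_i + a_i x` with `{b_i}` an
`F₂`-basis of `E` and all column-spaces `span_{F₂}{g₁(α), …, g_ℓ(α)}` (for `α ∈ E*`)
of dimension `ℓ − 1`. Then `α ↦ span_{F₂}{g_i(α)}` is injective on `E*`, and every
`(ℓ−1)`-dimensional `F₂`-subspace of `E` occurs exactly once among these spans:
every bandwidth-optimal linear repair scheme for a full-length Reed–Solomon code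
with `n = 2^ℓ` and `r = 2` is rotational. -/
theorem stmt_7 (ℓ : ℕ) (hℓ : 1 ≤ ℓ)
    (E : Type*) [Field E] [Fintype E] [Algebra (ZMod 2) E]
    (hE : Fintype.card E = 2 ^ ℓ)
    (a b : Fin ℓ → E)
    (hb : LinearIndependent (ZMod 2) b)
    (hdim : ∀ α : E, α ≠ 0 →
      Module.finrank (ZMod 2)
        ↥(Submodule.span (ZMod 2) (Set.range (fun i : Fin ℓ => b i + a i * α)))
      = ℓ - 1) :
    Set.InjOn
      (fun α : E =>
        Submodule.span (ZMod 2) (Set.range (fun i : Fin ℓ => b i + a i * α)))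
      {α : E | α ≠ 0} ∧
    ∀ T : Submodule (ZMod 2) E, Module.finrank (ZMod 2) T = ℓ - 1 →
      ∃ α : E, α ≠ 0 ∧
        Submodule.span (ZMod 2) (Set.range (fun i : Fin ℓ => b i + a i * α)) = T := by
  have hfin : Module.finrank (ZMod 2) E = ℓ := by
    have h := Module.card_eq_pow_finrank (K := ZMod 2) (V := E)
    rw [hE, ZMod.card] at h
    exact (Nat.pow_right_injective le_rfl h).symm
  have : Nonempty (Fin ℓ) := ⟨⟨0, hℓ⟩⟩
  let B := basisOfLinearIndependentOfCardEqFinrank hb (by simp [hfin])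
  have hB : ⇑B = b := coe_basisOfLinearIndependentOfCardEqFinrank hb _
  let f : E →ₗ[ZMod 2] E := B.constr (ZMod 2) a
  have hspan (α : E) : Submodule.span (ZMod 2) (Set.range (fun i : Fin ℓ => b i + a i * α)) =
      LinearMap.range (repairMap f α) := by
    rw [LinearMap.range_eq_map, ← B.span_eq, Submodule.map_span, ← Set.range_comp]
    congr 2
    ext i
    rw [Function.comp_apply, repairMap_apply, B.constr_basis, hB]
  replace hdim (α : E) (hα : α ≠ 0) :
      Module.finrank (ZMod 2) (LinearMap.range (repairMap f α)) = ℓ - 1 := hspan α ▸ hdim α hα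
  simp only [hspan]
  have hne_top {H : Submodule (ZMod 2) E} (hH : Module.finrank (ZMod 2) H = ℓ - 1) : H ≠ ⊤ := by
    rintro rfl
    rw [finrank_top] at hH
    omega
  have hf : Function.Surjective f := by
    refine LinearMap.injective_iff_surjective.1
      (injective_of_forall_not_injective_repairMap f fun α hα hinj ↦ hne_top (hdim α hα) ?_)
    exact LinearMap.range_eq_top.2 (LinearMap.injective_iff_surjective.1 hinj)
  refine ⟨fun α hα β _ hαβ ↦
    eq_of_range_repairMap_le hf (hne_top (hdim α hα)) le_rfl hαβ.ge, fun T hT ↦ ?_⟩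
  obtain ⟨φ, hφ, hTφ⟩ := Submodule.exists_le_ker_of_lt_top T (hne_top hT).lt_top
  obtain ⟨α, hα, hle⟩ := exists_range_repairMap_le_ker hf hφ
  have hker : Module.finrank (ZMod 2) (LinearMap.ker φ) ≤ ℓ - 1 := by
    have h := Submodule.finrank_lt (mt LinearMap.ker_eq_top.1 hφ)
    omega
  refine ⟨α, hα, ?_⟩
  rw [Submodule.eq_of_le_of_finrank_le hle (hker.trans (hdim α hα).ge),
    Submodule.eq_of_le_of_finrank_le hTφ (hker.trans hT.ge)]
end
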